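/- (Theorem 1, monotonicity part.) For every cell i and all load vectors ρ, ρ' ∈ ℝ^n with 0 ≤ ρ' ≤ ρ componentwise, one has f_i(ρ') ≤ f_i(ρ); equivalently, f(ρ') ≤ f(ρ) componentwise. -/

import Mathlib

open Finset
open scoped Classical

/-- Multi-cell NOMA load-coupling model: `n` cells, a finite set `J` of UEs
(each served by exactly one cell), and a finite index type `C` of candidate UE clusters. -/
structure NomaModel (n : ℕ) (J C : Type) [Fintype J] [Fintype C] where
  /-- the serving cell of each UE -/
  serving : J → Fin n
  /-- the cell that each cluster belongs to -/
  cell : C → Fin n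
  /-- the UEs forming each cluster -/
  members : C → Finset J
  /-- channel gain from cell `k` to UE `j` -/
  g : Fin n → J → ℝ
  /-- per-RB transmit power of each cell -/
  p : Fin n → ℝ
  /-- intra-cluster power split: power allocated to UE `j` within cluster `u` -/
  psplit : C → J → ℝ
  /-- decoding order on each cluster -/
  b : C → J → ℕ
  /-- noise power -/
  σsq : ℝ
  /-- number of RBs -/
  M : ℝ
  /-- per-RB bandwidth -/
  B : ℝ
  /-- UE demands -/
  d : J → ℝ
  /-- load limit -/
  ρbar : ℝ
  members_nonempty : ∀ u, (members u).Nonempty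
  members_served : ∀ u, ∀ j ∈ members u, serving j = cell u
  covers : ∀ j, ∃ u, j ∈ members u
  g_pos : ∀ k j, 0 < g k j
  p_pos : ∀ k, 0 < p k
  psplit_pos : ∀ u, ∀ j ∈ members u, 0 < psplit u j
  psplit_sum : ∀ u, ∑ j ∈ members u, psplit u j = p (cell u)
  b_injOn : ∀ u, Set.InjOn (b u) (members u)
  σsq_pos : 0 < σsq
  M_pos : 0 < M
  B_pos : 0 < B
  d_nonneg : ∀ j, 0 ≤ d j
  ρbar_pos : 0 < ρbar
  ρbar_le_one : ρbar ≤ 1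

namespace NomaModel

variable {n : ℕ} {J C : Type} [Fintype J] [Fintype C]

/-- SINR of UE `j` in cluster `u` under load vector `ρ` (eq. (1) with averaged
inter-cell interference (2)). -/
noncomputable def sinr (mdl : NomaModel n J C) (ρ : Fin n → ℝ) (u : C) (j : J) : ℝ :=
  mdl.psplit u j * mdl.g (mdl.cell u) j /
    ((∑ h ∈ (mdl.members u).filter (fun h => mdl.b u h < mdl.b u j),
        mdl.psplit u h * mdl.g (mdl.cell u) j)
      + (∑ k ∈ Finset.univ.filter (fun k => k ≠ mdl.cell u), mdl.p k * mdl.g k j * ρ k)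
      + mdl.σsq)

/-- Total capacity over all RBs for UE `j` in cluster `u` (eq. (3)). -/
noncomputable def cap (mdl : NomaModel n J C) (ρ : Fin n → ℝ) (u : C) (j : J) : ℝ :=
  mdl.M * mdl.B * Real.log (1 + mdl.sinr ρ u j)

/-- A load vector `ρ` is feasible if `0 ≤ ρ_i ≤ ρ̄` for every cell and some nonnegative
resource allocation `x` over clusters realizes the loads and meets all UE demands
(eqs. (1)–(5)). -/
noncomputable def Feasible (mdl : NomaModel n J C) (ρ : Fin n → ℝ) : Prop :=
  (∀ i, 0 ≤ ρ i ∧ ρ i ≤ mdl.ρbar) ∧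
  ∃ x : C → ℝ, (∀ u, 0 ≤ x u) ∧
    (∀ i, ρ i = ∑ u ∈ Finset.univ.filter (fun u => mdl.cell u = i), x u) ∧
    (∀ j, mdl.d j ≤ ∑ u ∈ Finset.univ.filter (fun u => j ∈ mdl.members u),
      mdl.cap ρ u j * x u)

/-- Per-cell minimum-load function `f_i(ρ)` (eqs. (7)/(8)): the minimum load of cell `i`
needed to serve the demands of its UEs, given the other cells' loads `ρ`. -/
noncomputable def f (mdl : NomaModel n J C) (ρ : Fin n → ℝ) (i : Fin n) : ℝ :=
  sInf { s : ℝ | ∃ x : C → ℝ, (∀ u, 0 ≤ x u) ∧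
    (∀ j, mdl.serving j = i →
      mdl.d j ≤ ∑ u ∈ Finset.univ.filter (fun u => mdl.cell u = i ∧ j ∈ mdl.members u),
        mdl.cap ρ u j * x u) ∧
    s = ∑ u ∈ Finset.univ.filter (fun u => mdl.cell u = i), x u }

end NomaModel

theorem NomaModel.den_pos {n : ℕ} {J C : Type} [Fintype J] [Fintype C]
    (mdl : NomaModel n J C) (ρ : Fin n → ℝ) (hρ : ∀ i, 0 ≤ ρ i) (u : C) (j : J) :
    0 < (∑ h ∈ (mdl.members u).filter (fun h => mdl.b u h < mdl.b u j),
        mdl.psplit u h * mdl.g (mdl.cell u) j)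
      + (∑ k ∈ Finset.univ.filter (fun k => k ≠ mdl.cell u), mdl.p k * mdl.g k j * ρ k)
      + mdl.σsq := by
  have h1 : 0 ≤ ∑ h ∈ (mdl.members u).filter (fun h => mdl.b u h < mdl.b u j),
        mdl.psplit u h * mdl.g (mdl.cell u) j :=
    Finset.sum_nonneg fun h hh =>
      mul_nonneg (mdl.psplit_pos u h (Finset.mem_filter.1 hh).1).le (mdl.g_pos _ _).le
  have h2 : 0 ≤ ∑ k ∈ Finset.univ.filter (fun k => k ≠ mdl.cell u), mdl.p k * mdl.g k j * ρ k :=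
    Finset.sum_nonneg fun k _ =>
      mul_nonneg (mul_nonneg (mdl.p_pos k).le (mdl.g_pos _ _).le) (hρ k)
  have h3 := mdl.σsq_pos
  linarith

theorem NomaModel.sinr_pos {n : ℕ} {J C : Type} [Fintype J] [Fintype C]
    (mdl : NomaModel n J C) (ρ : Fin n → ℝ) (hρ : ∀ i, 0 ≤ ρ i) (u : C) (j : J)
    (hj : j ∈ mdl.members u) : 0 < mdl.sinr ρ u j :=
  div_pos (mul_pos (mdl.psplit_pos u j hj) (mdl.g_pos _ _)) (mdl.den_pos ρ hρ u j)

theorem NomaModel.cap_pos {n : ℕ} {J C : Type} [Fintype J] [Fintype C]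
    (mdl : NomaModel n J C) (ρ : Fin n → ℝ) (hρ : ∀ i, 0 ≤ ρ i) (u : C) (j : J)
    (hj : j ∈ mdl.members u) : 0 < mdl.cap ρ u j := by
  have := mdl.sinr_pos ρ hρ u j hj
  exact mul_pos (mul_pos mdl.M_pos mdl.B_pos) (Real.log_pos (by linarith))

theorem NomaModel.cap_anti {n : ℕ} {J C : Type} [Fintype J] [Fintype C]
    (mdl : NomaModel n J C) (ρ ρ' : Fin n → ℝ)
    (hρ' : ∀ i, 0 ≤ ρ' i) (hle : ∀ i, ρ' i ≤ ρ i) (u : C) (j : J)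
    (hj : j ∈ mdl.members u) : mdl.cap ρ u j ≤ mdl.cap ρ' u j := by
  have hρ : ∀ i, 0 ≤ ρ i := fun i => (hρ' i).trans (hle i)
  have hpos := mdl.sinr_pos ρ hρ u j hj
  have hs : mdl.sinr ρ u j ≤ mdl.sinr ρ' u j := by
    refine div_le_div_of_nonneg_left
      (mul_pos (mdl.psplit_pos u j hj) (mdl.g_pos _ _)).le (mdl.den_pos ρ' hρ' u j) ?_
    have : ∑ k ∈ Finset.univ.filter (fun k => k ≠ mdl.cell u), mdl.p k * mdl.g k j * ρ' k
        ≤ ∑ k ∈ Finset.univ.filter (fun k => k ≠ mdl.cell u), mdl.p k * mdl.g k j * ρ k :=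
      Finset.sum_le_sum fun k _ => mul_le_mul_of_nonneg_left (hle k)
        (mul_pos (mdl.p_pos k) (mdl.g_pos _ _)).le
    linarith
  exact mul_le_mul_of_nonneg_left (Real.log_le_log (by linarith) (by linarith))
    (mul_pos mdl.M_pos mdl.B_pos).le

/-- Theorem 1, monotonicity part: for all load vectors `0 ≤ ρ' ≤ ρ` (componentwise)
and every cell `i`, `f_i(ρ') ≤ f_i(ρ)`. -/
theorem NomaModel.f_monotone {n : ℕ} {J C : Type} [Fintype J] [Fintype C]
    (mdl : NomaModel n J C) (ρ ρ' : Fin n → ℝ)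
    (hρ' : ∀ i, 0 ≤ ρ' i) (hle : ∀ i, ρ' i ≤ ρ i) :
    ∀ i, mdl.f ρ' i ≤ mdl.f ρ i := by
  intro i
  have hρ : ∀ i, 0 ≤ ρ i := fun i => (hρ' i).trans (hle i)
  unfold NomaModel.f
  apply csInf_le_csInf
  · refine ⟨0, ?_⟩
    rintro s ⟨x, hx, -, rfl⟩
    exact Finset.sum_nonneg fun u _ => hx u
  · -- feasibility: every UE can be served with enough resource
    have hterm : ∀ u, ∀ j ∈ mdl.members u, 0 ≤ mdl.d j / mdl.cap ρ u j := fun u j hj =>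
      div_nonneg (mdl.d_nonneg j) (mdl.cap_pos ρ hρ u j hj).le
    have hx : ∀ u, 0 ≤ ∑ j ∈ mdl.members u, mdl.d j / mdl.cap ρ u j := fun u =>
      Finset.sum_nonneg (hterm u)
    refine ⟨_, fun u => ∑ j ∈ mdl.members u, mdl.d j / mdl.cap ρ u j, hx, ?_, rfl⟩
    intro j hj
    obtain ⟨u, hu⟩ := mdl.covers j
    have hc := mdl.cap_pos ρ hρ u j hu
    have h1 : mdl.d j ≤ mdl.cap ρ u j * ∑ h ∈ mdl.members u, mdl.d h / mdl.cap ρ u h := by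
      calc mdl.d j = mdl.cap ρ u j * (mdl.d j / mdl.cap ρ u j) := by field_simp
        _ ≤ _ := mul_le_mul_of_nonneg_left
          (Finset.single_le_sum (f := fun h => mdl.d h / mdl.cap ρ u h) (hterm u) hu) hc.le
    refine h1.trans (Finset.single_le_sum
      (f := fun u => mdl.cap ρ u j * ∑ h ∈ mdl.members u, mdl.d h / mdl.cap ρ u h) ?_ ?_)
    · intro v hv
      exact mul_nonneg (mdl.cap_pos ρ hρ v j (Finset.mem_filter.1 hv).2.2).le (hx v)
    · exact Finset.mem_filter.2 ⟨Finset.mem_univ _, (mdl.members_served u j hu).symm.trans hj, hu⟩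
  · rintro s ⟨x, hx, hd, rfl⟩
    refine ⟨x, hx, fun j hj => (hd j hj).trans ?_, rfl⟩
    exact Finset.sum_le_sum fun u hu => mul_le_mul_of_nonneg_right
      (mdl.cap_anti ρ ρ' hρ' hle u j (Finset.mem_filter.1 hu).2.2) (hx u)
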